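/- Let g be a real-analytic function on a neighbourhood of the origin in ℝ² with g(0,0) = 0, ∂g/∂y(0,0) = 0, ∂²g/∂y²(0,0) = 0 and ∂³g/∂y³(0,0) ≠ 0. Then g is an admissible discriminant if and only if there exist an open neighbourhood V of the origin, a number δ ∈ {0,1}, and a smooth function φ : V → ℝ with φ(0,0) = 0 and ∂φ/∂y(p) ≠ 0 for all p ∈ V, such that g(x,y) = φ(x,y)³ + δ·x²/4 on V. -/

import Mathlib

open Real Set

/-- Partial derivative with respect to the first coordinate `x`. -/
noncomputable def pdx (f : ℝ × ℝ → ℝ) (p : ℝ × ℝ) : ℝ := fderiv ℝ f p (1, 0)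

/-- Partial derivative with respect to the second coordinate `y`. -/
noncomputable def pdy (f : ℝ × ℝ → ℝ) (p : ℝ × ℝ) : ℝ := fderiv ℝ f p (0, 1)

/-- A quadruple `(a,b,c,d)` of smooth functions on `U ⊆ ℝ²` is a Nijenhuis operator if the
two essential components of the Nijenhuis torsion of `L = [[a,b],[c,d]]` vanish on `U`. -/
def IsNijenhuisOn (U : Set (ℝ × ℝ)) (a b c d : ℝ × ℝ → ℝ) : Prop :=
  ContDiffOn ℝ (⊤ : ℕ∞) a U ∧ ContDiffOn ℝ (⊤ : ℕ∞) b U ∧ ContDiffOn ℝ (⊤ : ℕ∞) c U ∧ ContDiffOn ℝ (⊤ : ℕ∞) d U ∧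
  ∀ p ∈ U,
    pdy a p * (a p - d p) + pdy (fun q => b q * c q) p - pdx (fun q => a q + d q) p * b p = 0 ∧
    pdx d p * (a p - d p) - pdx (fun q => b q * c q) p + pdy (fun q => a q + d q) p * c p = 0

/-- `g` is an admissible discriminant (relative to its domain of definition `U`): there are an
open neighbourhood `V ⊆ U` of the origin and a Nijenhuis operator `(a,b,c,d)` on `V` with
trace `x` whose discriminant equals `g` on `V`. -/
def AdmissibleDiscriminantOn (U : Set (ℝ × ℝ)) (g : ℝ × ℝ → ℝ) : Prop :=
  ∃ V : Set (ℝ × ℝ), V ⊆ U ∧ IsOpen V ∧ (0, 0) ∈ V ∧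
    ∃ a b c d : ℝ × ℝ → ℝ, IsNijenhuisOn V a b c d ∧
      (∀ p ∈ V, a p + d p = p.1) ∧
      (∀ p ∈ V, ((a p + d p) / 2) ^ 2 - (a p * d p - b p * c p) = g p)

open Filter Topology MeasureTheory

section PartialDerivatives

variable {f g : ℝ × ℝ → ℝ} {p : ℝ × ℝ}

theorem contDiff_pdx (hf : ContDiff ℝ (⊤ : ℕ∞) f) : ContDiff ℝ (⊤ : ℕ∞) (pdx f) :=
  (hf.fderiv_right (m := (⊤ : ℕ∞)) (by simp)).clm_apply contDiff_const

theorem contDiff_pdy (hf : ContDiff ℝ (⊤ : ℕ∞) f) : ContDiff ℝ (⊤ : ℕ∞) (pdy f) :=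
  (hf.fderiv_right (m := (⊤ : ℕ∞)) (by simp)).clm_apply contDiff_const

theorem contDiffOn_pdx {V : Set (ℝ × ℝ)} (hV : IsOpen V) (hf : ContDiffOn ℝ (⊤ : ℕ∞) f V) :
    ContDiffOn ℝ (⊤ : ℕ∞) (pdx f) V :=
  (hf.fderiv_of_isOpen (m := (⊤ : ℕ∞)) hV (by simp)).clm_apply contDiffOn_const

theorem contDiffOn_pdy {V : Set (ℝ × ℝ)} (hV : IsOpen V) (hf : ContDiffOn ℝ (⊤ : ℕ∞) f V) :
    ContDiffOn ℝ (⊤ : ℕ∞) (pdy f) V :=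
  (hf.fderiv_of_isOpen (m := (⊤ : ℕ∞)) hV (by simp)).clm_apply contDiffOn_const

theorem AnalyticAt.pdx (hf : AnalyticAt ℝ f p) : AnalyticAt ℝ (pdx f) p :=
  ((ContinuousLinearMap.apply ℝ ℝ ((1 : ℝ), (0 : ℝ))).analyticAt _).comp hf.fderiv

theorem AnalyticAt.pdy (hf : AnalyticAt ℝ f p) : AnalyticAt ℝ (pdy f) p :=
  ((ContinuousLinearMap.apply ℝ ℝ ((0 : ℝ), (1 : ℝ))).analyticAt _).comp hf.fderiv

theorem Filter.EventuallyEq.pdx (h : f =ᶠ[𝓝 p] g) : pdx f =ᶠ[𝓝 p] pdx g := by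
  filter_upwards [h.fderiv (𝕜 := ℝ)] with q hq
  simp only [_root_.pdx, hq]

theorem Filter.EventuallyEq.pdy (h : f =ᶠ[𝓝 p] g) : pdy f =ᶠ[𝓝 p] pdy g := by
  filter_upwards [h.fderiv (𝕜 := ℝ)] with q hq
  simp only [_root_.pdy, hq]

theorem pdx_add (hf : DifferentiableAt ℝ f p) (hg : DifferentiableAt ℝ g p) :
    pdx (fun q => f q + g q) p = pdx f p + pdx g p := by
  simp [pdx, fderiv_fun_add hf hg]

theorem pdy_add (hf : DifferentiableAt ℝ f p) (hg : DifferentiableAt ℝ g p) :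
    pdy (fun q => f q + g q) p = pdy f p + pdy g p := by
  simp [pdy, fderiv_fun_add hf hg]

theorem pdx_mul (hf : DifferentiableAt ℝ f p) (hg : DifferentiableAt ℝ g p) :
    pdx (fun q => f q * g q) p = pdx f p * g p + f p * pdx g p := by
  simp [pdx, fderiv_fun_mul hf hg]; ring

theorem pdy_mul (hf : DifferentiableAt ℝ f p) (hg : DifferentiableAt ℝ g p) :
    pdy (fun q => f q * g q) p = pdy f p * g p + f p * pdy g p := by
  simp [pdy, fderiv_fun_mul hf hg]; ring

theorem pdx_pow (hf : DifferentiableAt ℝ f p) (n : ℕ) :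
    pdx (fun q => f q ^ n) p = n * f p ^ (n - 1) * pdx f p := by
  simp [pdx, fderiv_fun_pow n hf]

theorem pdy_pow (hf : DifferentiableAt ℝ f p) (n : ℕ) :
    pdy (fun q => f q ^ n) p = n * f p ^ (n - 1) * pdy f p := by
  simp [pdy, fderiv_fun_pow n hf]

theorem pdx_const_mul (hf : DifferentiableAt ℝ f p) (r : ℝ) :
    pdx (fun q => r * f q) p = r * pdx f p := by
  simp [pdx, fderiv_const_mul hf]

theorem pdy_const_mul (hf : DifferentiableAt ℝ f p) (r : ℝ) :
    pdy (fun q => r * f q) p = r * pdy f p := by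
  simp [pdy, fderiv_const_mul hf]

theorem pdx_fst : pdx (fun q => q.1) p = 1 := by
  rw [pdx, (hasFDerivAt_fst (𝕜 := ℝ) (p := p)).fderiv]
  rfl

theorem pdy_fst : pdy (fun q => q.1) p = 0 := by
  rw [pdy, (hasFDerivAt_fst (𝕜 := ℝ) (p := p)).fderiv]
  rfl

theorem pdy_snd : pdy (fun q => q.2) p = 1 := by
  rw [pdy, (hasFDerivAt_snd (𝕜 := ℝ) (p := p)).fderiv]
  rfl

theorem pdy_comp_fst {u : ℝ → ℝ} (hu : DifferentiableAt ℝ u p.1) :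
    pdy (fun q => u q.1) p = 0 := by
  have h : HasFDerivAt (fun q : ℝ × ℝ => u q.1) _ p :=
    hu.hasDerivAt.comp_hasFDerivAt p (f := fun q : ℝ × ℝ => q.1) (hasFDerivAt_fst (𝕜 := ℝ))
  simp [pdy, h.fderiv]

theorem hasDerivAt_along_y (hf : DifferentiableAt ℝ f p) :
    HasDerivAt (fun t => f (p.1, t)) (pdy f p) p.2 := by
  have h : HasDerivAt (fun t : ℝ => (p.1, t)) ((0 : ℝ), (1 : ℝ)) p.2 :=
    (hasDerivAt_const p.2 p.1).prodMk (hasDerivAt_id p.2)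
  exact HasFDerivAt.comp_hasDerivAt p.2 (f := fun t : ℝ => (p.1, t)) hf.hasFDerivAt h

theorem hasDerivAt_along_graph {s : ℝ → ℝ} {x : ℝ} (hf : DifferentiableAt ℝ f (x, s x))
    (hs : DifferentiableAt ℝ s x) :
    HasDerivAt (fun z => f (z, s z)) (pdx f (x, s x) + pdy f (x, s x) * deriv s x) x := by
  have h : HasDerivAt (fun z : ℝ => (z, s z)) ((1 : ℝ), deriv s x) x :=
    (hasDerivAt_id x).prodMk hs.hasDerivAt
  have h2 := HasFDerivAt.comp_hasDerivAt x (f := fun z : ℝ => (z, s z)) hf.hasFDerivAt h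
  have e : ((1 : ℝ), deriv s x) = (1, 0) + deriv s x • ((0 : ℝ), (1 : ℝ)) := by simp
  rw [e, map_add, map_smul, smul_eq_mul, mul_comm] at h2
  exact h2

theorem pdx_pdy_comm (hf : ContDiff ℝ (⊤ : ℕ∞) f) : pdx (pdy f) = pdy (pdx f) := by
  ext q
  have hd : DifferentiableAt ℝ (fderiv ℝ f) q :=
    (hf.fderiv_right (m := (⊤ : ℕ∞)) (by simp)).differentiable (by simp) q
  have hsym := ((contDiff_infty.1 hf 2).contDiffAt (x := q)).isSymmSndFDerivAt (by simp)
  have e1 : ∀ v w : ℝ × ℝ, fderiv ℝ (fun r => fderiv ℝ f r v) q w = fderiv ℝ (fderiv ℝ f) q w v := by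
    intro v w
    rw [fderiv_clm_apply hd (differentiableAt_const v)]
    simp
  change fderiv ℝ (fun r => fderiv ℝ f r (0, 1)) q (1, 0) =
    fderiv ℝ (fun r => fderiv ℝ f r (1, 0)) q (0, 1)
  rw [e1, e1]
  exact hsym _ _

end PartialDerivatives

section HadamardLemma

theorem exists_contDiff_eventuallyEq {E : Type*} [NormedAddCommGroup E] [NormedSpace ℝ E]
    [FiniteDimensional ℝ E] {V : Set E} (hV : IsOpen V) {f : E → ℝ} {p : E}
    (hp : p ∈ V) (hf : ContDiffOn ℝ (⊤ : ℕ∞) f V) :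
    ∃ F : E → ℝ, ContDiff ℝ (⊤ : ℕ∞) F ∧ F =ᶠ[𝓝 p] f := by
  obtain ⟨r, hr, hrV⟩ := Metric.nhds_basis_closedBall.mem_iff.1 (hV.mem_nhds hp)
  let β : ContDiffBump p := ⟨r / 2, r, by positivity, by linarith⟩
  refine ⟨fun q => β q * f q, ?_, ?_⟩
  · refine contDiff_iff_contDiffAt.2 fun q => ?_
    by_cases hq : q ∈ V
    · exact β.contDiff.contDiffAt.mul (hf.contDiffAt (hV.mem_nhds hq))
    · have hq' : q ∉ tsupport β := fun h => hq (hrV (by simpa [β.tsupport_eq] using h))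
      have : (fun q => β q * f q) =ᶠ[𝓝 q] fun _ => 0 := by
        filter_upwards [notMem_tsupport_iff_eventuallyEq.1 hq'] with z hz
        simp [hz]
      exact contDiffAt_const.congr_of_eventuallyEq this
  · filter_upwards [β.eventuallyEq_one] with q hq
    simp [hq]

theorem contDiff_integral_Icc {E : Type*} [NormedAddCommGroup E] [NormedSpace ℝ E]
    {H : E × ℝ → ℝ} (hH : ContDiff ℝ (⊤ : ℕ∞) H) :
    ContDiff ℝ (⊤ : ℕ∞) fun p => ∫ t in Icc (0 : ℝ) 1, H (p, t) := by
  let χ : ContDiffBump (0 : ℝ) := ⟨1, 2, by norm_num, by norm_num⟩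
  have key := contDiffOn_convolution_right_with_param_comp (𝕜 := ℝ) (n := ⊤) (μ := volume)
    (ContinuousLinearMap.mul ℝ ℝ) (s := (univ : Set E)) (v := fun _ => (0 : ℝ)) contDiffOn_const
    (f := (Icc (0 : ℝ) 1).indicator fun _ => 1) (g := fun p z => χ z * H (p, -z))
    (k := Metric.closedBall (0 : ℝ) 2) isOpen_univ (isCompact_closedBall _ _)
    (fun p x _ hx => by
      have : χ x = 0 := by
        apply χ.zero_of_le_dist
        simp only [Metric.mem_closedBall, not_le] at hx
        exact hx.le
      simp [this])
    ((locallyIntegrable_const 1).indicator measurableSet_Icc)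
    (by
      refine ContDiff.contDiffOn ?_
      have h1 : ContDiff ℝ (⊤ : ℕ∞) (fun q : E × ℝ => χ q.2) := χ.contDiff.comp contDiff_snd
      have h2 : ContDiff ℝ (⊤ : ℕ∞) (fun q : E × ℝ => H (q.1, -q.2)) :=
        hH.comp (contDiff_fst.prodMk contDiff_snd.neg)
      exact h1.mul h2)
  rw [contDiffOn_univ] at key
  convert key using 2 with p
  rw [convolution_mul, ← integral_indicator measurableSet_Icc]
  congr 1
  ext t
  by_cases ht : t ∈ Icc (0 : ℝ) 1
  · have : χ (-t) = 1 := by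
      apply χ.one_of_mem_closedBall
      simp only [Metric.mem_closedBall, dist_zero_right, norm_neg, Real.norm_eq_abs]
      exact abs_le.2 ⟨by linarith [ht.1], ht.2⟩
    simp [ht, this]
  · simp [ht]

theorem exists_contDiff_eq_add_mul {K : ℝ × ℝ → ℝ} (hK : ContDiff ℝ (⊤ : ℕ∞) K) :
    ∃ K₁ : ℝ × ℝ → ℝ, ContDiff ℝ (⊤ : ℕ∞) K₁ ∧ ∀ x t, K (x, t) = K (x, 0) + t * K₁ (x, t) := by
  refine ⟨fun p => ∫ τ in Icc (0 : ℝ) 1, pdy K (p.1, τ * p.2), ?_, fun x t => ?_⟩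
  · exact contDiff_integral_Icc (H := fun q : (ℝ × ℝ) × ℝ => pdy K (q.1.1, q.2 * q.1.2))
      ((contDiff_pdy hK).comp (by fun_prop))
  · have hd : ∀ τ ∈ uIcc (0 : ℝ) 1,
        HasDerivAt (fun τ => K (x, τ * t)) (pdy K (x, τ * t) * t) τ := by
      intro τ _
      have h1 := hasDerivAt_along_y (p := (x, τ * t)) (hK.differentiable (by simp) (x, τ * t))
      have h2 : HasDerivAt (fun τ : ℝ => τ * t) t τ := by
        simpa using (hasDerivAt_id τ).mul_const t
      exact HasDerivAt.comp τ (h₂ := fun y => K (x, y)) h1 h2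
    have hc : Continuous fun τ : ℝ => pdy K (x, τ * t) * t :=
      ((contDiff_pdy hK).continuous.comp (by fun_prop)).mul continuous_const
    have := intervalIntegral.integral_eq_sub_of_hasDerivAt hd (hc.intervalIntegrable _ _)
    rw [intervalIntegral.integral_mul_const, intervalIntegral.integral_of_le zero_le_one,
      ← integral_Icc_eq_integral_Ioc] at this
    simp only [one_mul, zero_mul] at this
    linarith

end HadamardLemma

section OneVariable

theorem eq_of_eventually_pow_mul_eq {F G : ℝ → ℝ} (n : ℕ) (hF : ContinuousAt F 0)
    (hG : ContinuousAt G 0) (h : ∀ᶠ x in 𝓝 0, x ^ n * F x = x ^ n * G x) : F 0 = G 0 := by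
  refine Filter.EventuallyEq.eq_of_nhds ((hF.eventuallyEq_nhds_iff_eventuallyEq_nhdsNE hG).1 ?_)
  filter_upwards [h.filter_mono nhdsWithin_le_nhds, self_mem_nhdsWithin] with x hx hx0
  exact mul_left_cancel₀ (pow_ne_zero n hx0) hx

theorem AnalyticAt.dslope_self {f : ℝ → ℝ} {x : ℝ} (hf : AnalyticAt ℝ f x) :
    AnalyticAt ℝ (dslope f x) x := by
  obtain ⟨p, hp⟩ := hf
  exact ⟨_, hp.has_fpower_series_dslope_fslope⟩

theorem eventually_eq_zero_of_critical_system {A B P C : ℝ → ℝ} (hA : AnalyticAt ℝ A 0)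
    (hB : AnalyticAt ℝ B 0) (hP : ContinuousAt P 0) (hC : ContinuousAt C 0)
    (hA0 : A 0 = 0) (hB0 : B 0 = 0)
    (hBeq : ∀ᶠ x in 𝓝 0, B x = deriv B x ^ 2 + A x * C x)
    (hAeq : ∀ᶠ x in 𝓝 0, A x * P x = 2 * deriv B x * deriv A x)
    (h_ne : deriv A 0 ≠ 0 → C 0 ≠ 0) (h_eq : deriv A 0 = 0 → C 0 = 0 ∧ P 0 = 2 / 3) :
    ∀ᶠ x in 𝓝 0, A x = 0 := by
  by_contra hne
  obtain ⟨m, u, hu, hu0, hAu⟩ := hA.exists_eventuallyEq_pow_smul_nonzero_iff.2 hne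
  simp only [sub_zero, smul_eq_mul] at hAu
  obtain ⟨k, rfl⟩ : ∃ k, m = k + 1 := by
    refine Nat.exists_eq_succ_of_ne_zero fun hm => hu0 ?_
    have := hAu.self_of_nhds
    simpa [hm, hA0] using this.symm
  have hA' : ∀ᶠ x in 𝓝 0, deriv A x = x ^ k * ((k + 1) * u x + x * deriv u x) := by
    filter_upwards [EventuallyEq.deriv hAu, hu.eventually_analyticAt] with x hx hux
    rw [hx, deriv_fun_mul (by fun_prop) hux.differentiableAt]
    simp
    ring
  have hB'0 : deriv B 0 = 0 := by
    have := hBeq.self_of_nhds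
    simpa [hA0, hB0] using this.symm
  obtain ⟨β, hβ, hBβ⟩ : ∃ β : ℝ → ℝ, AnalyticAt ℝ β 0 ∧ B = fun x => x ^ 2 * β x := by
    refine ⟨dslope (dslope B 0) 0, hB.dslope_self.dslope_self, ?_⟩
    ext x
    have h1 := sub_smul_dslope B 0 x
    have h2 := sub_smul_dslope (dslope B 0) 0 x
    simp only [dslope_same, hB'0, hB0, sub_zero, smul_eq_mul] at h1 h2
    rw [← h1, ← h2]
    ring
  have hB' : ∀ᶠ x in 𝓝 0, deriv B x = x * (2 * β x + x * deriv β x) := by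
    filter_upwards [hβ.eventually_analyticAt] with x hx
    rw [hBβ, deriv_fun_mul (by fun_prop) hx.differentiableAt]
    simp
    ring
  have cu := hu.continuousAt
  have cu' := hu.deriv.continuousAt
  have cβ := hβ.continuousAt
  have cβ' := hβ.deriv.continuousAt
  have hPval : u 0 * P 0 = 2 * (2 * β 0) * ((k + 1) * u 0) := by
    have := eq_of_eventually_pow_mul_eq (k + 1) (F := fun x => u x * P x)
      (G := fun x => 2 * (2 * β x + x * deriv β x) * ((k + 1) * u x + x * deriv u x))
      (by fun_prop) (by fun_prop) (by
        filter_upwards [hAeq, hAu, hA', hB'] with x h1 h2 h3 h4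
        rw [h2, h3, h4] at h1
        linear_combination h1)
    simpa using this
  have hPval' : P 0 = 4 * β 0 * (k + 1) := mul_left_cancel₀ hu0 (by linear_combination hPval)
  cases k with
  | zero =>
    have hC0 : C 0 ≠ 0 := h_ne (by rw [hA'.self_of_nhds]; simpa using hu0)
    have := eq_of_eventually_pow_mul_eq 1 (F := fun x => x * β x)
      (G := fun x => x * (2 * β x + x * deriv β x) ^ 2 + u x * C x)
      (by fun_prop) (by fun_prop) (by
        filter_upwards [hBeq, hAu, hB'] with x h1 h2 h3
        rw [h2, h3, hBβ] at h1
        linear_combination h1)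
    simp [hu0, hC0] at this
  | succ j =>
    obtain ⟨hC0, hP0⟩ := h_eq (by rw [hA'.self_of_nhds]; simp)
    have := eq_of_eventually_pow_mul_eq 2 (F := β)
      (G := fun x => (2 * β x + x * deriv β x) ^ 2 + x ^ j * (u x * C x))
      (by fun_prop) (by fun_prop) (by
        filter_upwards [hBeq, hAu, hB'] with x h1 h2 h3
        rw [h2, h3, hBβ] at h1
        linear_combination h1)
    simp only [zero_mul, add_zero, hC0, mul_zero] at this
    push_cast at hPval'
    have hj : (0 : ℝ) ≤ j := Nat.cast_nonneg j
    have h4 : β 0 * (1 - 4 * β 0) = 0 := by linear_combination this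
    rcases mul_eq_zero.1 h4 with h | h
    · rw [h, hP0] at hPval'
      norm_num at hPval'
    · have : β 0 = 1 / 4 := by linarith
      rw [this, hP0] at hPval'
      linarith

theorem eventually_eq_zero_or_sq_div_four {B : ℝ → ℝ} (hB : AnalyticAt ℝ B 0) (hB0 : B 0 = 0)
    (hBeq : ∀ᶠ x in 𝓝 0, B x = deriv B x ^ 2) :
    ∃ δ : ℝ, (δ = 0 ∨ δ = 1) ∧ ∀ᶠ x in 𝓝 0, B x = δ * x ^ 2 / 4 := by
  have hB'0 : deriv B 0 = 0 := by simpa [hB0] using hBeq.self_of_nhds.symm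
  rcases hB.deriv.eventually_eq_zero_or_eventually_ne_zero with h | h
  · refine ⟨0, Or.inl rfl, ?_⟩
    filter_upwards [h, hBeq] with x h1 h2
    simp [h2, h1]
  · refine ⟨1, Or.inr rfl, ?_⟩
    have hB'' : ∀ᶠ x in 𝓝[≠] 0, deriv (deriv B) x = 1 / 2 := by
      have hd : ∀ᶠ x in 𝓝 0, deriv B x = 2 * deriv B x * deriv (deriv B) x := by
        filter_upwards [EventuallyEq.deriv hBeq, hB.deriv.eventually_analyticAt] with x h1 h2
        rw [deriv_fun_pow h2.differentiableAt] at h1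
        simpa using h1
      filter_upwards [h, hd.filter_mono nhdsWithin_le_nhds] with x h1 h2
      exact mul_left_cancel₀ h1 (by linear_combination -h2 / 2)
    have hB''' : ∀ᶠ x in 𝓝 0, deriv (deriv B) x = 1 / 2 :=
      (hB.deriv.deriv.continuousAt.eventuallyEq_nhds_iff_eventuallyEq_nhdsNE
        continuousAt_const).1 hB''
    obtain ⟨r, hr, hball⟩ := Metric.eventually_nhds_iff_ball.1
      (hB'''.and hB.deriv.eventually_analyticAt)
    have hB' : ∀ x ∈ Metric.ball (0 : ℝ) r, deriv B x = x / 2 := by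
      intro x hx
      have := Metric.isOpen_ball.is_const_of_deriv_eq_zero
        (convex_ball (0 : ℝ) r).isPreconnected (f := fun x => deriv B x - x / 2)
        (fun y hy => ((hball y hy).2.differentiableAt.sub
          (by fun_prop)).differentiableWithinAt)
        (fun y hy => by
          rw [deriv_fun_sub (hball y hy).2.differentiableAt (by fun_prop), (hball y hy).1]
          simp)
        hx (Metric.mem_ball_self hr)
      simp only [hB'0] at this
      linarith
    filter_upwards [hBeq, Metric.ball_mem_nhds 0 hr] with x h1 h2
    rw [h1, hB' x h2]
    ring

end OneVariable

section CriticalCurve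

theorem eventually_pdy_of_eq_sq_add_mul {g w c : ℝ × ℝ → ℝ} {o : ℝ × ℝ}
    (hg : ContDiff ℝ (⊤ : ℕ∞) g) (hw : ContDiff ℝ (⊤ : ℕ∞) w) (hc : ContDiff ℝ (⊤ : ℕ∞) c)
    (h : ∀ᶠ p in 𝓝 o, g p = w p * w p + c p * pdy g p) :
    (∀ᶠ p in 𝓝 o, pdy g p = 2 * (w p * pdy w p) +
      (pdy c p * pdy g p + c p * pdy (pdy g) p)) ∧
    (∀ᶠ p in 𝓝 o, pdy (pdy g) p = 2 * (pdy w p * pdy w p + w p * pdy (pdy w) p) +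
      (pdy (pdy c) p * pdy g p + 2 * (pdy c p * pdy (pdy g) p) + c p * pdy (pdy (pdy g)) p)) ∧
    (∀ᶠ p in 𝓝 o, pdy (pdy (pdy g)) p =
      2 * (3 * (pdy w p * pdy (pdy w) p) + w p * pdy (pdy (pdy w)) p) +
      (pdy (pdy (pdy c)) p * pdy g p + 3 * (pdy (pdy c) p * pdy (pdy g) p) +
        3 * (pdy c p * pdy (pdy (pdy g)) p) + c p * pdy (pdy (pdy (pdy g))) p)) := by
  have diff : ∀ {f : ℝ × ℝ → ℝ}, ContDiff ℝ (⊤ : ℕ∞) f → ∀ p, DifferentiableAt ℝ f p :=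
    fun hf p => hf.differentiable (by simp) p
  have dg1 := diff (contDiff_pdy hg)
  have dg2 := diff (contDiff_pdy (contDiff_pdy hg))
  have dg3 := diff (contDiff_pdy (contDiff_pdy (contDiff_pdy hg)))
  have dw := diff hw
  have dw1 := diff (contDiff_pdy hw)
  have dw2 := diff (contDiff_pdy (contDiff_pdy hw))
  have dc := diff hc
  have dc1 := diff (contDiff_pdy hc)
  have dc2 := diff (contDiff_pdy (contDiff_pdy hc))
  have e1 : ∀ᶠ p in 𝓝 o, pdy g p = 2 * (w p * pdy w p) +
      (pdy c p * pdy g p + c p * pdy (pdy g) p) := by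
    filter_upwards [EventuallyEq.pdy h] with p hp
    refine hp.trans ?_
    rw [pdy_add ((dw p).fun_mul (dw p)) ((dc p).fun_mul (dg1 p)), pdy_mul (dw p) (dw p),
      pdy_mul (dc p) (dg1 p)]
    ring
  have e2 : ∀ᶠ p in 𝓝 o, pdy (pdy g) p = 2 * (pdy w p * pdy w p + w p * pdy (pdy w) p) +
      (pdy (pdy c) p * pdy g p + 2 * (pdy c p * pdy (pdy g) p) +
        c p * pdy (pdy (pdy g)) p) := by
    filter_upwards [EventuallyEq.pdy e1] with p hp
    refine hp.trans ?_
    rw [pdy_add (((dw p).fun_mul (dw1 p)).const_mul 2)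
        (((dc1 p).fun_mul (dg1 p)).fun_add ((dc p).fun_mul (dg2 p))),
      pdy_const_mul ((dw p).fun_mul (dw1 p)), pdy_mul (dw p) (dw1 p),
      pdy_add ((dc1 p).fun_mul (dg1 p)) ((dc p).fun_mul (dg2 p)), pdy_mul (dc1 p) (dg1 p),
      pdy_mul (dc p) (dg2 p)]
    ring
  refine ⟨e1, e2, ?_⟩
  filter_upwards [EventuallyEq.pdy e2] with p hp
  refine hp.trans ?_
  rw [pdy_add ((((dw1 p).fun_mul (dw1 p)).fun_add ((dw p).fun_mul (dw2 p))).const_mul 2)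
      ((((dc2 p).fun_mul (dg1 p)).fun_add (((dc1 p).fun_mul (dg2 p)).const_mul 2)).fun_add ((dc p).fun_mul (dg3 p))),
    pdy_const_mul (((dw1 p).fun_mul (dw1 p)).fun_add ((dw p).fun_mul (dw2 p))),
    pdy_add ((dw1 p).fun_mul (dw1 p)) ((dw p).fun_mul (dw2 p)),
    pdy_mul (dw1 p) (dw1 p), pdy_mul (dw p) (dw2 p),
    pdy_add (((dc2 p).fun_mul (dg1 p)).fun_add (((dc1 p).fun_mul (dg2 p)).const_mul 2)) ((dc p).fun_mul (dg3 p)),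
    pdy_add ((dc2 p).fun_mul (dg1 p)) (((dc1 p).fun_mul (dg2 p)).const_mul 2),
    pdy_const_mul ((dc1 p).fun_mul (dg2 p)), pdy_mul (dc2 p) (dg1 p), pdy_mul (dc1 p) (dg2 p),
    pdy_mul (dc p) (dg3 p)]
  ring

theorem exists_analyticAt_curve {f : ℝ × ℝ → ℝ} (hf : AnalyticAt ℝ f (0, 0)) (h0 : f (0, 0) = 0)
    (h1 : pdy f (0, 0) ≠ 0) :
    ∃ s : ℝ → ℝ, AnalyticAt ℝ s 0 ∧ s 0 = 0 ∧ ∀ᶠ x in 𝓝 0, f (x, s x) = 0 := by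
  have cdf : ContDiffAt ℝ ⊤ f (0, 0) := hf.contDiffAt
  have hinv : (fderiv ℝ f (0, 0) ∘L .inr ℝ ℝ ℝ).IsInvertible := by
    refine ⟨ContinuousLinearEquiv.unitsEquivAut ℝ (Units.mk0 _ h1), ?_⟩
    ext
    simp [pdy]
  exact ⟨cdf.implicitFunction (by simp) hinv,
    (cdf.contDiffAt_implicitFunction (by simp) hinv).analyticAt,
    cdf.implicitFunction_apply_self (by simp) hinv, by
      simpa [h0] using cdf.eventually_apply_implicitFunction (by simp) hinv⟩

theorem exists_triple_curve {g c : ℝ × ℝ → ℝ} (hg : ContDiff ℝ (⊤ : ℕ∞) g)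
    (hga : AnalyticAt ℝ g (0, 0)) (hc : ContDiff ℝ (⊤ : ℕ∞) c) (h0 : g (0, 0) = 0)
    (h1 : pdy g (0, 0) = 0) (h2 : pdy (pdy g) (0, 0) = 0) (h3 : pdy (pdy (pdy g)) (0, 0) ≠ 0)
    (h : ∀ᶠ p in 𝓝 (0, 0), g p = pdx g p * pdx g p + c p * pdy g p) :
    ∃ s : ℝ → ℝ, AnalyticAt ℝ s 0 ∧ s 0 = 0 ∧ ∃ δ : ℝ, (δ = 0 ∨ δ = 1) ∧
      ∀ᶠ x in 𝓝 0, g (x, s x) = δ * x ^ 2 / 4 ∧ pdy g (x, s x) = 0 ∧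
        pdy (pdy g) (x, s x) = 0 := by
  obtain ⟨s, hs, hs0, hs2⟩ := exists_analyticAt_curve hga.pdy.pdy h2 h3
  refine ⟨s, hs, hs0, ?_⟩
  have diff : ∀ {f : ℝ × ℝ → ℝ}, ContDiff ℝ (⊤ : ℕ∞) f → ∀ p, DifferentiableAt ℝ f p :=
    fun hf p => hf.differentiable (by simp) p
  have hsc : ContinuousAt (fun x => (x, s x)) 0 := continuousAt_id.prodMk hs.continuousAt
  have tends : Tendsto (fun x => (x, s x)) (𝓝 0) (𝓝 (0, 0)) := by
    simpa [ContinuousAt, hs0] using hsc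
  have hana : ∀ {f : ℝ × ℝ → ℝ}, AnalyticAt ℝ f (0, 0) → AnalyticAt ℝ (fun x => f (x, s x)) 0 := by
    intro f hf
    refine AnalyticAt.comp (g := f) (f := fun x => (x, s x)) ?_ (analyticAt_id.prod hs)
    simpa only [hs0] using hf
  have hcont : ∀ {f : ℝ × ℝ → ℝ}, ContDiff ℝ (⊤ : ℕ∞) f → ContinuousAt (fun x => f (x, s x)) 0 :=
    fun hf => hf.continuous.continuousAt.comp hsc
  have hw := contDiff_pdx hg
  obtain ⟨e1, e2, e3⟩ := eventually_pdy_of_eq_sq_add_mul hg hw hc h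
  have comm1 : pdx (pdy g) = pdy (pdx g) := pdx_pdy_comm hg
  have comm2 : pdx (pdy (pdy g)) = pdy (pdy (pdx g)) := by
    rw [pdx_pdy_comm (contDiff_pdy hg), comm1]
  have hdB : ∀ᶠ x in 𝓝 0, deriv (fun z => g (z, s z)) x =
      pdx g (x, s x) + pdy g (x, s x) * deriv s x := by
    filter_upwards [hs.eventually_analyticAt] with x hx
    exact (hasDerivAt_along_graph (diff hg _) hx.differentiableAt).deriv
  have hdA : ∀ᶠ x in 𝓝 0, deriv (fun z => pdy g (z, s z)) x = pdy (pdx g) (x, s x) := by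
    filter_upwards [hs.eventually_analyticAt, hs2] with x hx hx2
    rw [(hasDerivAt_along_graph (diff (contDiff_pdy hg) _) hx.differentiableAt).deriv, hx2, comm1]
    ring
  have hd2 : ∀ᶠ x in 𝓝 0, pdy (pdy (pdx g)) (x, s x) +
      pdy (pdy (pdy g)) (x, s x) * deriv s x = 0 := by
    filter_upwards [hs.eventually_analyticAt, EventuallyEq.deriv hs2] with x hx hx2
    rw [(hasDerivAt_along_graph (diff (contDiff_pdy (contDiff_pdy hg)) _)
      hx.differentiableAt).deriv, comm2] at hx2
    simpa using hx2
  have E0 := tends.eventually h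
  have E1 := tends.eventually e1
  have E2 := tends.eventually e2
  have E3 := tends.eventually e3
  have w0 : pdx g (0, 0) = 0 := by
    have := h.self_of_nhds
    simpa [h0, h1] using this.symm
  have E2' := e2.self_of_nhds
  have E3' := e3.self_of_nhds
  have hdA0 := hdA.self_of_nhds
  simp only [hs0, h1, h2, w0, zero_mul, mul_zero, add_zero, zero_add] at E2' E3' hdA0
  have hA0 : ∀ᶠ x in 𝓝 0, pdy g (x, s x) = 0 := by
    refine eventually_eq_zero_of_critical_system (A := fun x => pdy g (x, s x))
      (B := fun x => g (x, s x))
      (P := fun x => 1 - pdy c (x, s x) + 2 * deriv s x * pdy (pdx g) (x, s x))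
      (C := fun x => c (x, s x) - 2 * (pdx g (x, s x) + pdy g (x, s x) * deriv s x) * deriv s x +
        pdy g (x, s x) * deriv s x ^ 2)
      (hana hga.pdy) (hana hga) ?_ ?_ (by simpa [hs0] using h1) (by simpa [hs0] using h0)
      ?_ ?_ ?_ ?_
    · have i1 := hcont (contDiff_pdy hc)
      have i2 := hcont (contDiff_pdy hw)
      have i3 := hs.deriv.continuousAt
      fun_prop
    · have i0 := hc.continuous
      have i1 := hs.continuousAt
      have i2 := hcont hw
      have i3 := hs.deriv.continuousAt
      have i4 := hcont (contDiff_pdy hg)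
      fun_prop
    · filter_upwards [E0, hdB] with x k0 k1
      rw [k1]
      linear_combination k0
    · filter_upwards [E1, hdB, hdA, hs2] with x k0 k1 k2 k3
      rw [k1, k2]
      rw [k3] at k0
      linear_combination k0
    · intro hne hC0
      simp only [hs0, h1, w0, zero_mul, mul_zero, add_zero, sub_zero] at hC0
      rw [hdA0] at hne
      rw [hC0] at E2'
      apply hne
      simpa using E2'.symm
    · intro heq
      rw [hdA0] at heq
      simp only [hs0, h1, w0, heq, zero_mul, mul_zero, add_zero, sub_zero, zero_add] at E2' E3' ⊢
      have hc0 : c (0, 0) = 0 := by simpa [h3] using E2'.symm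
      refine ⟨hc0, ?_⟩
      rw [hc0] at E3'
      have : pdy c (0, 0) = 1 / 3 := mul_right_cancel₀ h3 (by linear_combination -E3' / 3)
      rw [this]
      norm_num
  obtain ⟨δ, hδ, hB⟩ := eventually_eq_zero_or_sq_div_four (B := fun x => g (x, s x)) (hana hga)
    (by simpa [hs0] using h0) (by
      filter_upwards [E0, hdB, hA0] with x k0 k1 k2
      rw [k1, k0, k2]
      ring)
  refine ⟨δ, hδ, ?_⟩
  filter_upwards [hB, hA0, hs2] with x k0 k1 k2 using ⟨k0, k1, k2⟩

end CriticalCurve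

section CubeRoot

theorem pdy_iterate_of_eq_add_mul {K K₁ : ℝ × ℝ → ℝ} (hK₁ : ContDiff ℝ (⊤ : ℕ∞) K₁)
    {u : ℝ → ℝ} (hu : Differentiable ℝ u) (h : ∀ x t, K (x, t) = u x + t * K₁ (x, t)) (x : ℝ) :
    pdy K (x, 0) = K₁ (x, 0) ∧ pdy (pdy K) (x, 0) = 2 * pdy K₁ (x, 0) ∧
      pdy (pdy (pdy K)) (x, 0) = 3 * pdy (pdy K₁) (x, 0) := by
  have diff : ∀ {f : ℝ × ℝ → ℝ}, ContDiff ℝ (⊤ : ℕ∞) f → ∀ p, DifferentiableAt ℝ f p :=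
    fun hf p => hf.differentiable (by simp) p
  have snd_mul : ∀ {f : ℝ × ℝ → ℝ}, ContDiff ℝ (⊤ : ℕ∞) f → ∀ p : ℝ × ℝ,
      pdy (fun q => q.2 * f q) p = f p + p.2 * pdy f p := by
    intro f hf p
    rw [pdy_mul differentiableAt_snd (diff hf p), pdy_snd, one_mul]
  have snd_diff : ∀ {f : ℝ × ℝ → ℝ}, ContDiff ℝ (⊤ : ℕ∞) f → ∀ p : ℝ × ℝ,
      DifferentiableAt ℝ (fun q : ℝ × ℝ => q.2 * f q) p :=
    fun hf p => differentiableAt_snd.fun_mul (diff hf p)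
  have c1 := contDiff_pdy hK₁
  have c2 := contDiff_pdy c1
  have e0 : K = fun q => u q.1 + q.2 * K₁ q := by
    ext ⟨x, t⟩
    exact h x t
  have e1 : pdy K = fun q => K₁ q + q.2 * pdy K₁ q := by
    ext p
    have du : DifferentiableAt ℝ (fun q : ℝ × ℝ => u q.1) p := (hu p.1).comp p differentiableAt_fst
    rw [e0, pdy_add du (snd_diff hK₁ p),
      pdy_comp_fst (hu p.1), snd_mul hK₁]
    ring
  have e2 : pdy (pdy K) = fun q => 2 * pdy K₁ q + q.2 * pdy (pdy K₁) q := by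
    ext p
    rw [e1, pdy_add (diff hK₁ p) (snd_diff c1 p), snd_mul c1]
    ring
  have e3 : pdy (pdy (pdy K)) = fun q => 3 * pdy (pdy K₁) q + q.2 * pdy (pdy (pdy K₁)) q := by
    ext p
    rw [e2, pdy_add ((diff c1 p).const_mul 2) (snd_diff c2 p), pdy_const_mul (diff c1 p),
      snd_mul c2]
    ring
  rw [e3, e2, e1]
  simp

theorem exists_contDiff_cubic_taylor {K : ℝ × ℝ → ℝ} (hK : ContDiff ℝ (⊤ : ℕ∞) K) :
    ∃ R : ℝ × ℝ → ℝ, ContDiff ℝ (⊤ : ℕ∞) R ∧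
      (∀ x t, K (x, t) =
        K (x, 0) + t * pdy K (x, 0) + t ^ 2 * pdy (pdy K) (x, 0) / 2 + t ^ 3 * R (x, t)) ∧
      ∀ x, pdy (pdy (pdy K)) (x, 0) = 6 * R (x, 0) := by
  have restr : ∀ {f : ℝ × ℝ → ℝ}, ContDiff ℝ (⊤ : ℕ∞) f → Differentiable ℝ fun x => f (x, 0) :=
    fun hf => (hf.comp (contDiff_id.prodMk contDiff_const)).differentiable (by simp)
  obtain ⟨K₁, h₁, e₁⟩ := exists_contDiff_eq_add_mul hK
  obtain ⟨K₂, h₂, e₂⟩ := exists_contDiff_eq_add_mul h₁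
  obtain ⟨K₃, h₃, e₃⟩ := exists_contDiff_eq_add_mul h₂
  have d₁ := pdy_iterate_of_eq_add_mul h₁ (restr hK) e₁
  have d₂ := pdy_iterate_of_eq_add_mul h₂ (restr h₁) e₂
  have d₃ := pdy_iterate_of_eq_add_mul h₃ (restr h₂) e₃
  refine ⟨K₃, h₃, fun x t => ?_, fun x => ?_⟩
  · rw [e₁ x t, e₂ x t, e₃ x t, (d₁ x).1, (d₁ x).2.1, (d₂ x).1]
    ring
  · rw [(d₁ x).2.2, (d₂ x).2.1, (d₃ x).1]
    ring

theorem exists_contDiffOn_pow_three_eq_of_pos {E : Type*} [NormedAddCommGroup E]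
    [NormedSpace ℝ E] {u : E → ℝ} {o : E} (hu : ContDiff ℝ (⊤ : ℕ∞) u) (h : 0 < u o) :
    ∃ V : Set E, IsOpen V ∧ o ∈ V ∧ ∃ r : E → ℝ, ContDiffOn ℝ (⊤ : ℕ∞) r V ∧
      ∀ p ∈ V, r p ^ 3 = u p := by
  refine ⟨{p | 0 < u p}, isOpen_lt continuous_const hu.continuous, h,
    fun p => u p ^ (1 / 3 : ℝ), fun p hp => ?_, fun p hp => ?_⟩
  · exact (hu.contDiffAt.rpow_const_of_ne (ne_of_gt hp)).contDiffWithinAt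
  · have hp' : 0 ≤ u p := le_of_lt hp
    simp only
    rw [← Real.rpow_natCast, ← Real.rpow_mul hp']
    norm_num

theorem exists_contDiffOn_pow_three_eq {E : Type*} [NormedAddCommGroup E]
    [NormedSpace ℝ E] {u : E → ℝ} {o : E} (hu : ContDiff ℝ (⊤ : ℕ∞) u) (h : u o ≠ 0) :
    ∃ V : Set E, IsOpen V ∧ o ∈ V ∧ ∃ r : E → ℝ, ContDiffOn ℝ (⊤ : ℕ∞) r V ∧
      ∀ p ∈ V, r p ^ 3 = u p := by
  rcases h.lt_or_gt with hneg | hpos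
  · obtain ⟨V, hV, ho, r, hr, hr3⟩ :=
      exists_contDiffOn_pow_three_eq_of_pos (o := o) hu.neg (by simpa using hneg)
    exact ⟨V, hV, ho, fun p => -r p, hr.neg, fun p hp => by linear_combination -hr3 p hp⟩
  · exact exists_contDiffOn_pow_three_eq_of_pos hu hpos

theorem pdy_comp_shift {f : ℝ × ℝ → ℝ} (hf : Differentiable ℝ f) {s : ℝ → ℝ}
    (hs : Differentiable ℝ s) :
    pdy (fun q => f (q.1, s q.1 + q.2)) = fun q => pdy f (q.1, s q.1 + q.2) := by
  ext p
  have h1 := hasDerivAt_along_y (f := fun q => f (q.1, s q.1 + q.2)) (p := p) (by fun_prop)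
  have h2 := hasDerivAt_along_y (hf (p.1, s p.1 + p.2))
  have h3 := HasDerivAt.comp p.2 (h₂ := fun y => f (p.1, y)) h2
    ((hasDerivAt_id p.2).const_add (s p.1))
  rw [mul_one] at h3
  exact h1.unique h3

theorem exists_eq_pow_three_add {g : ℝ × ℝ → ℝ} (hg : ContDiff ℝ (⊤ : ℕ∞) g) {s v : ℝ → ℝ}
    (hs : ContDiff ℝ (⊤ : ℕ∞) s) (hs0 : s 0 = 0) (h3 : pdy (pdy (pdy g)) (0, 0) ≠ 0)
    (h : ∀ᶠ x in 𝓝 0, g (x, s x) = v x ∧ pdy g (x, s x) = 0 ∧ pdy (pdy g) (x, s x) = 0) :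
    ∃ V : Set (ℝ × ℝ), IsOpen V ∧ (0, 0) ∈ V ∧
      ∃ φ : ℝ × ℝ → ℝ, ContDiffOn ℝ (⊤ : ℕ∞) φ V ∧ φ (0, 0) = 0 ∧
        (∀ p ∈ V, pdy φ p ≠ 0) ∧ ∀ p ∈ V, g p = φ p ^ 3 + v p.1 := by
  have ds := hs.differentiable (by simp)
  have hk : ContDiff ℝ (⊤ : ℕ∞) fun q : ℝ × ℝ => g (q.1, s q.1 + q.2) := by fun_prop
  have k1 := pdy_comp_shift (hg.differentiable (by simp)) ds
  have k2 := pdy_comp_shift ((contDiff_pdy hg).differentiable (by simp)) ds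
  have k3 := pdy_comp_shift ((contDiff_pdy (contDiff_pdy hg)).differentiable (by simp)) ds
  obtain ⟨R, hR, hkR, hR3⟩ := exists_contDiff_cubic_taylor hk
  rw [k1, k2, k3] at hR3
  rw [k1, k2] at hkR
  simp only [add_zero] at hR3 hkR
  have hR0 : R (0, 0) ≠ 0 := by
    intro h0
    have := hR3 0
    rw [hs0, h0, mul_zero] at this
    exact h3 this
  obtain ⟨W, hW, hW0, r, hr, hr3⟩ := exists_contDiffOn_pow_three_eq (o := ((0 : ℝ), (0 : ℝ)))
    (u := fun p : ℝ × ℝ => R (p.1, p.2 - s p.1)) (by fun_prop) (by simpa [hs0] using hR0)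
  have hr0 : r (0, 0) ≠ 0 := by
    intro h0
    have := hr3 _ hW0
    simp only [h0, hs0, sub_zero] at this
    exact hR0 (by simpa using this.symm)
  obtain ⟨N, hN, hNo, hN0⟩ := eventually_nhds_iff.1 h
  have hφ : ContDiffOn ℝ (⊤ : ℕ∞) (fun p : ℝ × ℝ => (p.2 - s p.1) * r p) W :=
    ContDiffOn.mul (ContDiff.contDiffOn (by fun_prop)) hr
  have hφ0 : pdy (fun p : ℝ × ℝ => (p.2 - s p.1) * r p) (0, 0) ≠ 0 := by
    rw [pdy_mul (by fun_prop) ((hr.contDiffAt (hW.mem_nhds hW0)).differentiableAt (by simp))]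
    have h1 := hasDerivAt_along_y (f := fun p : ℝ × ℝ => p.2 - s p.1) (p := (0, 0)) (by fun_prop)
    have h2 : HasDerivAt (fun t : ℝ => t - s 0) 1 0 := (hasDerivAt_id 0).sub_const (s 0)
    rw [h1.unique h2]
    simpa [hs0] using hr0
  refine ⟨(W ∩ pdy (fun p : ℝ × ℝ => (p.2 - s p.1) * r p) ⁻¹' {0}ᶜ) ∩ Prod.fst ⁻¹' N,
    (((contDiffOn_pdy hW hφ).continuousOn.isOpen_inter_preimage hW
      isOpen_compl_singleton)).inter (hNo.preimage continuous_fst), ⟨⟨hW0, hφ0⟩, hN0⟩, _,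
    hφ.mono fun p hp => hp.1.1, by simp [hs0], fun p hp => hp.1.2, fun p hp => ?_⟩
  obtain ⟨n1, n2, n3⟩ := hN p.1 hp.2
  have e := hkR p.1 (p.2 - s p.1)
  rw [n1, n2, n3, ← hr3 p hp.1.1, add_sub_cancel] at e
  linear_combination e

end CubeRoot

section Discriminant

theorem IsNijenhuisOn.discriminant_eq {V : Set (ℝ × ℝ)} (hV : IsOpen V)
    {a b c d g : ℝ × ℝ → ℝ} (hN : IsNijenhuisOn V a b c d) (htr : ∀ p ∈ V, a p + d p = p.1)
    (hdisc : ∀ p ∈ V, ((a p + d p) / 2) ^ 2 - (a p * d p - b p * c p) = g p) :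
    ∀ p ∈ V, g p = pdx g p * pdx g p + c p * pdy g p := by
  intro p hp
  obtain ⟨ha, hb, hc, hd, hN⟩ := hN
  have hVp := hV.mem_nhds hp
  have da := (ha.contDiffAt hVp).differentiableAt (by simp)
  have db := (hb.contDiffAt hVp).differentiableAt (by simp)
  have dc := (hc.contDiffAt hVp).differentiableAt (by simp)
  have dl : DifferentiableAt ℝ (fun q : ℝ × ℝ => (-1 / 2) * q.1) p := by fun_prop
  have dal := da.fun_add dl
  have dbc := db.fun_mul dc
  have htr' : (fun q => a q + d q) =ᶠ[𝓝 p] fun q => q.1 := by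
    filter_upwards [hVp] with q hq using htr q hq
  have hd' : d =ᶠ[𝓝 p] fun q => q.1 + (-1) * a q := by
    filter_upwards [hVp] with q hq
    linear_combination htr q hq
  have hg' : g =ᶠ[𝓝 p] fun q => (a q + (-1 / 2) * q.1) ^ 2 + b q * c q := by
    filter_upwards [hVp] with q hq
    have h1 : d q = q.1 - a q := by linear_combination htr q hq
    rw [← hdisc q hq, h1]
    ring
  obtain ⟨e1, e2⟩ := hN p hp
  rw [htr'.pdx.eq_of_nhds, pdx_fst] at e1
  rw [htr'.pdy.eq_of_nhds, pdy_fst, hd'.pdx.eq_of_nhds, pdx_add differentiableAt_fst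
    (da.const_mul _), pdx_const_mul da, pdx_fst] at e2
  have hdp : d p = p.1 - a p := by linear_combination htr p hp
  rw [hdp] at e1 e2
  have gx : pdx g p = a p + (-1 / 2) * p.1 := by
    rw [hg'.pdx.eq_of_nhds, pdx_add (dal.fun_pow 2) dbc, pdx_pow dal, pdx_add da dl,
      pdx_const_mul differentiableAt_fst, pdx_fst]
    push_cast
    linear_combination -e2
  have gy : pdy g p = b p := by
    rw [hg'.pdy.eq_of_nhds, pdy_add (dal.fun_pow 2) dbc, pdy_pow dal, pdy_add da dl,
      pdy_const_mul differentiableAt_fst, pdy_fst]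
    push_cast
    linear_combination e1
  rw [gx, gy, hg'.eq_of_nhds]
  ring

theorem admissibleDiscriminantOn_of_eq {U V : Set (ℝ × ℝ)} (hVU : V ⊆ U) (hV : IsOpen V)
    (hV0 : (0, 0) ∈ V) {g c : ℝ × ℝ → ℝ} (hg : ContDiffOn ℝ (⊤ : ℕ∞) g V)
    (hc : ContDiffOn ℝ (⊤ : ℕ∞) c V)
    (h : ∀ p ∈ V, g p = pdx g p * pdx g p + c p * pdy g p) : AdmissibleDiscriminantOn U g := by
  have hgx := contDiffOn_pdx hV hg
  have hgy := contDiffOn_pdy hV hg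
  have hl : ContDiffOn ℝ (⊤ : ℕ∞) (fun q : ℝ × ℝ => (1 / 2) * q.1) V :=
    ContDiff.contDiffOn (by fun_prop)
  refine ⟨V, hVU, hV, hV0, fun q => (1 / 2) * q.1 + pdx g q, pdy g, c,
    fun q => (1 / 2) * q.1 + (-1) * pdx g q,
    ⟨hl.add hgx, hgy, hc, hl.add (contDiffOn_const.mul hgx), fun p hp => ?_⟩,
    fun p hp => by ring, fun p hp => by rw [h p hp]; ring⟩
  have hVp := hV.mem_nhds hp
  have dg := (hg.contDiffAt hVp).differentiableAt (by simp)
  have dgx := (hgx.contDiffAt hVp).differentiableAt (by simp)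
  have dl := (hl.contDiffAt hVp).differentiableAt (by simp)
  have htr : (fun q : ℝ × ℝ => (1 / 2) * q.1 + pdx g q + ((1 / 2) * q.1 + (-1) * pdx g q)) =
      fun q => q.1 := by
    ext q
    ring
  have hbc : (fun q => pdy g q * c q) =ᶠ[𝓝 p] fun q => g q + (-1) * (pdx g q * pdx g q) := by
    filter_upwards [hVp] with q hq
    linear_combination -h q hq
  have dm := dgx.fun_mul dgx
  rw [htr, hbc.pdx.eq_of_nhds, hbc.pdy.eq_of_nhds, pdx_fst, pdy_fst,
    pdy_add dl dgx, pdx_add dl (dgx.const_mul _), pdx_const_mul differentiableAt_fst,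
    pdy_const_mul differentiableAt_fst, pdx_fst, pdy_fst, pdx_add dg (dm.const_mul _),
    pdy_add dg (dm.const_mul _), pdx_const_mul dm, pdy_const_mul dm, pdx_mul dgx dgx,
    pdy_mul dgx dgx, pdx_const_mul dgx]
  constructor <;> ring

theorem admissibleDiscriminantOn_of_cubic {U V : Set (ℝ × ℝ)} (hVU : V ⊆ U) (hV : IsOpen V)
    (hV0 : (0, 0) ∈ V) {g φ : ℝ × ℝ → ℝ} {δ : ℝ} (hδ : δ = 0 ∨ δ = 1)
    (hφ : ContDiffOn ℝ (⊤ : ℕ∞) φ V) (hφy : ∀ p ∈ V, pdy φ p ≠ 0)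
    (h : ∀ p ∈ V, g p = φ p ^ 3 + δ * p.1 ^ 2 / 4) : AdmissibleDiscriminantOn U g := by
  have hg : ContDiffOn ℝ (⊤ : ℕ∞) g V := by
    refine ContDiffOn.congr ?_ h
    exact (hφ.pow 3).add (ContDiff.contDiffOn (by fun_prop))
  have hx := contDiffOn_pdx hV hφ
  have hy := contDiffOn_pdy hV hφ
  refine admissibleDiscriminantOn_of_eq hVU hV hV0 hg
    (c := fun p => (φ p - 9 * φ p ^ 2 * pdx φ p ^ 2 - 3 * pdx φ p * (δ * p.1)) / (3 * pdy φ p))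
    ?_ fun p hp => ?_
  · refine ContDiffOn.div ?_ (contDiffOn_const.mul hy) fun p hp => by simpa using hφy p hp
    exact (hφ.sub ((contDiffOn_const.mul (hφ.pow 2)).mul (hx.pow 2))).sub
      ((contDiffOn_const.mul hx).mul (ContDiff.contDiffOn (by fun_prop)))
  · have dφ := (hφ.contDiffAt (hV.mem_nhds hp)).differentiableAt (by simp)
    have dq : DifferentiableAt ℝ (fun q : ℝ × ℝ => δ / 4 * q.1 ^ 2) p := by fun_prop
    have hg' : g =ᶠ[𝓝 p] fun q => φ q ^ 3 + δ / 4 * q.1 ^ 2 := by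
      filter_upwards [hV.mem_nhds hp] with q hq
      rw [h q hq]
      ring
    have gx : pdx g p = 3 * φ p ^ 2 * pdx φ p + δ / 2 * p.1 := by
      rw [hg'.pdx.eq_of_nhds, pdx_add (dφ.fun_pow 3) dq, pdx_pow dφ,
        pdx_const_mul (by fun_prop), pdx_pow differentiableAt_fst, pdx_fst]
      push_cast
      ring
    have gy : pdy g p = 3 * φ p ^ 2 * pdy φ p := by
      rw [hg'.pdy.eq_of_nhds, pdy_add (dφ.fun_pow 3) dq, pdy_pow dφ,
        pdy_const_mul (by fun_prop), pdy_pow differentiableAt_fst, pdy_fst]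
      push_cast
      ring
    have hy0 := hφy p hp
    have hδ2 : δ ^ 2 = δ := by rcases hδ with rfl | rfl <;> norm_num
    rw [gx, gy, hg'.eq_of_nhds]
    field_simp
    linear_combination (-4 * p.1 ^ 2) * hδ2

end Discriminant

theorem stmt10 (U : Set (ℝ × ℝ)) (hU : IsOpen U) (hU0 : (0, 0) ∈ U)
    (g : ℝ × ℝ → ℝ) (hg : AnalyticOnNhd ℝ g U)
    (h0 : g (0, 0) = 0) (h1 : pdy g (0, 0) = 0)
    (h2 : pdy (pdy g) (0, 0) = 0) (h3 : pdy (pdy (pdy g)) (0, 0) ≠ 0) :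
    AdmissibleDiscriminantOn U g ↔
      ∃ V : Set (ℝ × ℝ), V ⊆ U ∧ IsOpen V ∧ (0, 0) ∈ V ∧
        ∃ δ : ℝ, (δ = 0 ∨ δ = 1) ∧
          ∃ φ : ℝ × ℝ → ℝ, ContDiffOn ℝ (⊤ : ℕ∞) φ V ∧ φ (0, 0) = 0 ∧
            (∀ p ∈ V, pdy φ p ≠ 0) ∧
            (∀ p ∈ V, g p = (φ p) ^ 3 + δ * p.1 ^ 2 / 4) := by
  constructor
  · rintro ⟨V, hVU, hV, hV0, a, b, c, d, hN, htr, hdisc⟩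
    have heq := hN.discriminant_eq hV htr hdisc
    obtain ⟨G, hG, hGg⟩ := exists_contDiff_eventuallyEq hV hV0
      (hg.contDiffOn (n := (⊤ : ℕ∞)) hU.uniqueDiffOn |>.mono hVU)
    obtain ⟨C, hC, hCc⟩ := exists_contDiff_eventuallyEq hV hV0 hN.2.2.1
    have hGy := hGg.pdy
    have hG3 : pdy (pdy (pdy G)) (0, 0) ≠ 0 := by rwa [hGy.pdy.pdy.eq_of_nhds]
    obtain ⟨s, hs, hs0, δ, hδ, hcurve⟩ := exists_triple_curve hG
      ((hg _ hU0).congr hGg.symm) hC (by rwa [hGg.eq_of_nhds]) (by rwa [hGy.eq_of_nhds])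
      (by rwa [hGy.pdy.eq_of_nhds]) hG3 (by
        filter_upwards [hGg, hGg.pdx, hGy, hCc, hV.mem_nhds hV0] with p k1 k2 k3 k4 hp
        rw [k1, k2, k3, k4, heq p hp])
    obtain ⟨N, hsN, hN', hN0⟩ := eventually_nhds_iff.1 hs.eventually_analyticAt
    obtain ⟨S, hS, hSs⟩ := exists_contDiff_eventuallyEq hN' hN0 (f := s)
      (fun x hx => (hsN x hx).contDiffAt.contDiffWithinAt)
    obtain ⟨W, hW, hW0, φ, hφ, hφ0, hφy, hφ3⟩ := exists_eq_pow_three_add hG hS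
      (v := fun x => δ * x ^ 2 / 4) (by rw [hSs.eq_of_nhds, hs0]) hG3 (by
        filter_upwards [hcurve, hSs] with x k1 k2
        rwa [k2])
    obtain ⟨Z, hZ, hZo, hZ0⟩ := eventually_nhds_iff.1 hGg
    exact ⟨W ∩ Z ∩ U, inter_subset_right, (hW.inter hZo).inter hU, ⟨⟨hW0, hZ0⟩, hU0⟩, δ, hδ, φ,
      hφ.mono fun p hp => hp.1.1, hφ0, fun p hp => hφy p hp.1.1,
      fun p hp => by rw [← hZ p hp.1.2, hφ3 p hp.1.1]⟩
  · rintro ⟨V, hVU, hV, hV0, δ, hδ, φ, hφ, -, hφy, hφg⟩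
    exact admissibleDiscriminantOn_of_cubic hVU hV hV0 hδ hφ hφy hφg
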